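/- Let 𝔖 be a split system on a finite multiset 𝓜. If 𝔖 is compatible and (T,λ) is a representation of 𝔖, then for every terminal set A of 𝔖 there exists a leaf x of T such that λ(x) = A. -/

import Mathlib

open scoped Classical

/-- A split of a multiset `M`: an unordered pair of nonempty submultisets of `M`
whose multiset union is `M`. -/
def IsSplit {X : Type} (M : Multiset X) (S : Sym2 (Multiset X)) : Prop :=
  ∃ A B : Multiset X, S = s(A, B) ∧ A ≠ 0 ∧ B ≠ 0 ∧ A + B = M

/-- A split system on `M`: a multiset of splits of `M`. -/
def IsSplitSystem {X : Type} (M : Multiset X) (𝔖 : Multiset (Sym2 (Multiset X))) : Prop :=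
  ∀ S ∈ 𝔖, IsSplit M S

/-- An `M`-tree: a finite tree whose vertices are labelled by submultisets of `M`
such that (M1) the multiset union of all labels is `M`, and (M2) every vertex of
degree 1 or 2 has a nonempty label. -/
structure MTree (X : Type) (M : Multiset X) where
  n : ℕ
  G : SimpleGraph (Fin n)
  connected : G.Connected
  acyclic : G.IsAcyclic
  label : Fin n → Multiset X
  m1 : ∑ v, label v = M
  m2 : ∀ v, G.degree v = 1 ∨ G.degree v = 2 → label v ≠ 0

namespace MTree

variable {X : Type} {M : Multiset X}

/-- The part of the split induced by the edge `{u, v}` lying on the side of `u`: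
the multiset union of the labels of the vertices in the connected component of `u`
after deleting the edge `{u, v}`. -/
noncomputable def part (T : MTree X M) (u v : Fin T.n) : Multiset X :=
  ∑ w ∈ Finset.univ.filter (fun w => (T.G.deleteEdges {s(u, v)}).Reachable u w), T.label w

/-- The multiset of splits represented by an `M`-tree: the splits induced by its edges. -/
noncomputable def splits (T : MTree X M) : Multiset (Sym2 (Multiset X)) :=
  T.G.edgeFinset.val.map
    (Sym2.lift ⟨fun u v => s(T.part u v, T.part v u), fun u v => Sym2.eq_swap⟩)

end MTree

/-- A split system on `M` is compatible if some `M`-tree represents it. -/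
def Compatible {X : Type} (M : Multiset X) (𝔖 : Multiset (Sym2 (Multiset X))) : Prop :=
  ∃ T : MTree X M, T.splits = 𝔖

/-- `Δ(M) = Σ_{x ∈ X} (M(x) - 1)`. -/
def delta {X : Type} [DecidableEq X] (M : Multiset X) : ℕ :=
  ∑ x ∈ M.toFinset, (M.count x - 1)

/-- The split system `{S₁, …, Sₙ}` determined by an indexed family of ordered splits,
where split `i` has parts `P i true` and `P i false`. -/
def splitSystemOf {X : Type} {n : ℕ} (P : Fin n → Bool → Multiset X) :
    Multiset (Sym2 (Multiset X)) :=
  (Finset.univ.val : Multiset (Fin n)).map fun i => s(P i true, P i false)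

/-- The arcs of the split-containment graph `Γ(𝔖)`: its vertices are the pairs
`(i, b)` (representing the pair `(P i b, Sᵢ)` of a part of the split `Sᵢ` together
with `Sᵢ`), and there is an arc from `(i, b)` to `(j, c)` iff `i ≠ j` and
`P i b ⊊ P j c` as multisets. -/
def GammaArc {X : Type} {n : ℕ} (P : Fin n → Bool → Multiset X)
    (u v : Fin n × Bool) : Prop :=
  u.1 ≠ v.1 ∧ P u.1 u.2 < P v.1 v.2

/-- A thin subgraph of `Γ(𝔖)`: a spanning subgraph `G` of `Γ(𝔖)` such that for all
distinct `i, j` the restriction of `G` to the four vertices coming from `Sᵢ` and `Sⱼ`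
has exactly two arcs, of the form `((C,Sᵢ),(D,Sⱼ))` and `((D̄,Sⱼ),(C̄,Sᵢ))`. -/
def IsThinSubgraph {X : Type} {n : ℕ} (P : Fin n → Bool → Multiset X)
    (G : Fin n × Bool → Fin n × Bool → Prop) : Prop :=
  (∀ u v, G u v → GammaArc P u v) ∧
  ∀ i j : Fin n, i ≠ j → ∃ b c : Bool, ∀ b' c' : Bool,
    (G (i, b') (j, c') ↔ b' = b ∧ c' = c) ∧
    (G (j, c') (i, b') ↔ c' = !c ∧ b' = !b)

/-- An arc `(u, v)` of a digraph `G` is critical if the only directed path in `G`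
from `u` to `v` is the arc itself. -/
def IsCriticalArc {V : Type} (G : V → V → Prop) (u v : V) : Prop :=
  G u v ∧ ¬ ∃ w, G u w ∧ w ≠ v ∧ Relation.TransGen G w v

/-- A (thin) subgraph `G` of `Γ(𝔖)` is consistent if for every vertex `(A, Sᵢ)` of `G`,
the multiset union of the parts `B` over all vertices `(B, Sⱼ)` such that
`((B,Sⱼ),(A,Sᵢ))` is a critical arc of `G` is a submultiset of `A`. -/
def IsConsistent {X : Type} {n : ℕ} (P : Fin n → Bool → Multiset X)
    (G : Fin n × Bool → Fin n × Bool → Prop) : Prop :=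
  ∀ u : Fin n × Bool,
    (∑ w ∈ Finset.univ.filter (fun w => IsCriticalArc G w u), P w.1 w.2) ≤ P u.1 u.2

/-- A part `A` of a split `A|Ā ∈ 𝔖` is a terminal set of `𝔖` if for every split
`B|B̄` of `𝔖` other than (this occurrence of) `A|Ā`, neither `B ⊊ A` nor `B̄ ⊊ A`. -/
def IsTerminal {X : Type} [DecidableEq X] (M : Multiset X)
    (𝔖 : Multiset (Sym2 (Multiset X))) (A : Multiset X) : Prop :=
  s(A, M - A) ∈ 𝔖 ∧ ∀ T ∈ 𝔖.erase s(A, M - A), ∀ B ∈ T, ¬ B < A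

/-- A terminal set `A` of `𝔖` is a superterminal set if in addition, for every split
`B|B̄` of `𝔖` other than `A|Ā`, exactly one of `A ⊊ B`, `A ⊊ B̄` holds. -/
def IsSuperterminal {X : Type} [DecidableEq X] (M : Multiset X)
    (𝔖 : Multiset (Sym2 (Multiset X))) (A : Multiset X) : Prop :=
  IsTerminal M 𝔖 A ∧
    ∀ T ∈ 𝔖.erase s(A, M - A), ∀ B C : Multiset X, T = s(B, C) → (A < B ↔ ¬ A < C)

/-- Two splits are compatible if they have parts `A ∈ S₁`, `B ∈ S₂` with `A ∩ B = ∅`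
(multiset intersection). -/
def SplitPairCompatible {X : Type} [DecidableEq X] (S₁ S₂ : Sym2 (Multiset X)) : Prop :=
  ∃ A ∈ S₁, ∃ B ∈ S₂, A ∩ B = 0

/-- A split system is pairwise compatible if any two of its splits are compatible. -/
def PairwiseCompatible {X : Type} [DecidableEq X] (𝔖 : Multiset (Sym2 (Multiset X))) : Prop :=
  ∀ S₁ ∈ 𝔖, ∀ S₂ ∈ 𝔖.erase S₁, SplitPairCompatible S₁ S₂

/-- The size of a split `A|B` is `min {|A|, |B|}`. -/
def splitSize {X : Type} : Sym2 (Multiset X) → ℕ :=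
  Sym2.lift ⟨fun A B => min A.card B.card, fun A B => min_comm _ _⟩

/-- Isomorphism of `M`-trees: a graph isomorphism preserving the labels. -/
def MTreeIso {X : Type} {M : Multiset X} (T T' : MTree X M) : Prop :=
  ∃ φ : Fin T.n ≃ Fin T'.n,
    (∀ u v, T.G.Adj u v ↔ T'.G.Adj (φ u) (φ v)) ∧ ∀ v, T'.label (φ v) = T.label v

/-- Isomorphism of digraphs. -/
def DigraphIso {V W : Type} (R : V → V → Prop) (Q : W → W → Prop) : Prop :=
  ∃ φ : V ≃ W, ∀ a b, R a b ↔ Q (φ a) (φ b)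

/-- The digraph `D₁` on the four vertices `v = 0`, `w = 1`, `p = 2`, `q = 3`,
with arcs `(v,p)` and `(q,w)`. -/
def D1 : Fin 4 → Fin 4 → Prop := fun a b => (a = 0 ∧ b = 2) ∨ (a = 3 ∧ b = 1)

/-- The digraph `D₂` on the four vertices `v = 0`, `w = 1`, `p = 2`, `q = 3`,
with arcs `(v,p)`, `(p,w)`, `(v,q)` and `(q,w)`. -/
def D2 : Fin 4 → Fin 4 → Prop :=
  fun a b => (a = 0 ∧ b = 2) ∨ (a = 2 ∧ b = 1) ∨ (a = 0 ∧ b = 3) ∨ (a = 3 ∧ b = 1)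

/-- Isomorphism of subgraphs of `Γ(𝔖)`: a digraph isomorphism mapping each vertex
`(A, Sᵢ)` to a vertex `(B, Sⱼ)` with `A = B`. -/
def SubgraphIso {X : Type} {n : ℕ} (P : Fin n → Bool → Multiset X)
    (G G' : Fin n × Bool → Fin n × Bool → Prop) : Prop :=
  ∃ φ : Fin n × Bool ≃ Fin n × Bool,
    (∀ u v, G u v ↔ G' (φ u) (φ v)) ∧ ∀ u, P (φ u).1 (φ u).2 = P u.1 u.2

namespace SimpleGraph

variable {V : Type*} {G : SimpleGraph V} {u v w w' x : V}

theorem IsAcyclic.not_reachable_deleteEdges (hG : G.IsAcyclic) (h : G.Adj u v) :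
    ¬ (G.deleteEdges {s(u, v)}).Reachable u v := by
  have := isAcyclic_iff_forall_isBridge.1 hG ((mem_edgeSet G).2 h)
  rw [isBridge_iff] at this
  exact this

theorem IsAcyclic.reachable_deleteEdges_of_adj (hG : G.IsAcyclic) (hw : G.Adj u w)
    (hwv : w ≠ v) (hx : (G.deleteEdges {s(w, u)}).Reachable w x) :
    (G.deleteEdges {s(u, v)}).Reachable u x := by
  have hnot := hG.not_reachable_deleteEdges hw.symm
  have hstart : (G.deleteEdges {s(u, v)}).Reachable u w := by
    apply Adj.reachable
    rw [deleteEdges_adj]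
    refine ⟨hw, ?_⟩
    simp only [Set.mem_singleton_iff, Sym2.eq_iff, not_or, not_and]
    exact ⟨fun _ => hwv, fun _ h => hw.ne h.symm⟩
  rw [reachable_iff_reflTransGen] at hx
  induction hx with
  | refl => exact hstart
  | @tail b c hb hbc ih =>
    refine ih.trans (Adj.reachable ?_)
    have hb' : (G.deleteEdges {s(w, u)}).Reachable w b := (reachable_iff_reflTransGen _ _).2 hb
    have hc' := hb'.trans hbc.reachable
    rw [deleteEdges_adj] at hbc ⊢
    refine ⟨hbc.1, ?_⟩
    simp only [Set.mem_singleton_iff, Sym2.eq_iff]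
    rintro (⟨rfl, -⟩ | ⟨-, rfl⟩)
    exacts [hnot hb', hnot hc']

theorem IsAcyclic.not_reachable_deleteEdges_of_adj_of_adj (hG : G.IsAcyclic)
    (hw : G.Adj u w) (hw' : G.Adj u w') (hne : w ≠ w')
    (hx : (G.deleteEdges {s(w, u)}).Reachable w x) :
    ¬ (G.deleteEdges {s(w', u)}).Reachable w' x := by
  intro hx'
  have h := hG.reachable_deleteEdges_of_adj hw hne hx
  rw [Sym2.eq_swap] at h
  exact hG.not_reachable_deleteEdges hw'.symm (hx'.trans h.symm)

theorem eq_of_reachable_deleteEdges_of_forall_adj (hu : ∀ w, G.Adj u w → w = v)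
    (hx : (G.deleteEdges {s(u, v)}).Reachable u x) : x = u := by
  rw [reachable_iff_reflTransGen] at hx
  rcases hx.cases_head with h | ⟨c, hc, -⟩
  · exact h.symm
  · rw [deleteEdges_adj] at hc
    exact (hc.2 (by rw [hu c hc.1]; rfl)).elim

end SimpleGraph

namespace MTree

variable {X : Type} {M : Multiset X} {T : MTree X M} {u v w w' : Fin T.n}

theorem part_eq_label_of_forall_adj (hu : ∀ w, T.G.Adj u w → w = v) :
    T.part u v = T.label u := by
  have : Finset.univ.filter (fun w => (T.G.deleteEdges {s(u, v)}).Reachable u w) = {u} := by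
    ext x
    simp only [Finset.mem_filter, Finset.mem_univ, true_and, Finset.mem_singleton]
    refine ⟨SimpleGraph.eq_of_reachable_deleteEdges_of_forall_adj hu, ?_⟩
    rintro rfl
    rfl
  rw [part, this, Finset.sum_singleton]

theorem label_add_part_le (hw : T.G.Adj u w) (hwv : w ≠ v) :
    T.label u + T.part w u ≤ T.part u v := by
  unfold part
  rw [← Finset.sum_insert]
  · refine Finset.sum_le_sum_of_subset ?_
    intro x
    simp only [Finset.mem_insert, Finset.mem_filter, Finset.mem_univ, true_and]
    rintro (rfl | hx)
    · rfl
    · exact T.acyclic.reachable_deleteEdges_of_adj hw hwv hx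
  · simpa using T.acyclic.not_reachable_deleteEdges hw.symm

theorem part_add_part_le (hw : T.G.Adj u w) (hw' : T.G.Adj u w') (hwv : w ≠ v)
    (hwv' : w' ≠ v) (hne : w ≠ w') :
    T.part w u + T.part w' u ≤ T.part u v := by
  unfold part
  rw [← Finset.sum_union]
  · refine Finset.sum_le_sum_of_subset ?_
    intro x
    simp only [Finset.mem_union, Finset.mem_filter, Finset.mem_univ, true_and]
    rintro (hx | hx)
    · exact T.acyclic.reachable_deleteEdges_of_adj hw hwv hx
    · exact T.acyclic.reachable_deleteEdges_of_adj hw' hwv' hx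
  · rw [Finset.disjoint_left]
    intro x
    simp only [Finset.mem_filter, Finset.mem_univ, true_and]
    exact T.acyclic.not_reachable_deleteEdges_of_adj_of_adj hw hw' hne

theorem mem_splits_of_adj (h : T.G.Adj u v) : s(T.part u v, T.part v u) ∈ T.splits :=
  Multiset.mem_map.2 ⟨s(u, v), by simpa using h, rfl⟩

theorem part_ne_zero (hsys : IsSplitSystem M T.splits) (h : T.G.Adj u v) :
    T.part u v ≠ 0 := by
  obtain ⟨A, B, hAB, hA, hB, -⟩ := hsys _ (mem_splits_of_adj h)
  rcases Sym2.eq_iff.1 hAB with ⟨h, -⟩ | ⟨h, -⟩ <;> rwa [h]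

theorem mem_erase_splits_of_adj [DecidableEq (Sym2 (Multiset X))] (huv : T.G.Adj u v)
    (hw : T.G.Adj u w) (hwv : w ≠ v) :
    s(T.part w u, T.part u w) ∈ T.splits.erase s(T.part u v, T.part v u) := by
  have huv' : s(u, v) ∈ T.G.edgeFinset.val := by simpa using huv
  have hw' : s(w, u) ∈ T.G.edgeFinset.val := by simpa using hw.symm
  have hne : s(w, u) ≠ s(u, v) := by
    rw [Ne, Sym2.eq_iff, not_or]
    exact ⟨fun h => hw.ne h.1.symm, fun h => hwv h.1⟩
  obtain ⟨t, ht⟩ := Multiset.exists_cons_of_mem huv'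
  rw [ht, Multiset.mem_cons] at hw'
  have : s(T.part w u, T.part u w) ∈ t.map
      (Sym2.lift ⟨fun u v => s(T.part u v, T.part v u), fun u v => Sym2.eq_swap⟩) :=
    Multiset.mem_map.2 ⟨s(w, u), hw'.resolve_left hne, rfl⟩
  rw [splits, ht, Multiset.map_cons, Sym2.lift_mk, Multiset.erase_cons_head]
  exact this

theorem exists_part_lt (hsys : IsSplitSystem M T.splits) (huv : T.G.Adj u v)
    (hdeg : T.G.degree u ≠ 1) :
    ∃ w, T.G.Adj u w ∧ w ≠ v ∧ T.part w u < T.part u v := by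
  have hv : v ∈ T.G.neighborFinset u := by simpa using huv
  have hcard := Finset.card_erase_add_one hv
  rw [T.G.card_neighborFinset_eq_degree] at hcard
  obtain ⟨w, hw⟩ : ((T.G.neighborFinset u).erase v).Nonempty := by
    rw [← Finset.card_pos]
    omega
  have hw' := hw
  rw [Finset.mem_erase, SimpleGraph.mem_neighborFinset] at hw'
  obtain ⟨hwv, hadj⟩ := hw'
  refine ⟨w, hadj, hwv, ?_⟩
  by_cases hdeg2 : T.G.degree u = 2
  · exact (lt_add_of_pos_left _ (pos_iff_ne_zero.2 (T.m2 u (Or.inr hdeg2)))).trans_le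
      (label_add_part_le hadj hwv)
  · obtain ⟨w', hw'⟩ : (((T.G.neighborFinset u).erase v).erase w).Nonempty := by
      rw [← Finset.card_pos]
      have := Finset.card_erase_add_one hw
      omega
    simp only [Finset.mem_erase, SimpleGraph.mem_neighborFinset] at hw'
    obtain ⟨hne, hwv', hadj'⟩ := hw'
    exact (lt_add_of_pos_right _ (pos_iff_ne_zero.2 (part_ne_zero hsys hadj'.symm))).trans_le
      (part_add_part_le hadj hadj' hwv hwv' hne.symm)

theorem degree_eq_one_and_label_eq_part [DecidableEq (Sym2 (Multiset X))]
    (hsys : IsSplitSystem M T.splits) (huv : T.G.Adj u v)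
    (hmin : ∀ S ∈ T.splits.erase s(T.part u v, T.part v u), ∀ B ∈ S, ¬ B < T.part u v) :
    T.G.degree u = 1 ∧ T.label u = T.part u v := by
  have hdeg : T.G.degree u = 1 := by
    by_contra hdeg
    obtain ⟨w, hw, hwv, hlt⟩ := exists_part_lt hsys huv hdeg
    exact hmin _ (mem_erase_splits_of_adj huv hw hwv) _ (Sym2.mem_mk_left _ _) hlt
  refine ⟨hdeg, (part_eq_label_of_forall_adj fun w hw => ?_).symm⟩
  obtain ⟨y, -, hy⟩ := SimpleGraph.degree_eq_one_iff_existsUnique_adj.1 hdeg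
  exact (hy w hw).trans (hy v huv).symm

end MTree

/-- Lemma: terminal sets label leaves. Let `𝔖` be a split system on
`M`. If `𝔖` is compatible and `T` is a representation of `𝔖`, then for every terminal
set `A` of `𝔖` there exists a leaf `x` of `T` such that `λ(x) = A`. -/
theorem stmt6 {X : Type} [DecidableEq X] (M : Multiset X)
    (𝔖 : Multiset (Sym2 (Multiset X))) (hsys : IsSplitSystem M 𝔖)
    (T : MTree X M) (hrep : T.splits = 𝔖)
    (A : Multiset X) (hterm : IsTerminal M 𝔖 A) :
    ∃ x : Fin T.n, T.G.degree x = 1 ∧ T.label x = A := by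
  subst hrep
  obtain ⟨hmem, hmin⟩ := hterm
  obtain ⟨e, he, heq⟩ := Multiset.mem_map.1 hmem
  induction e using Sym2.ind with
  | _ u v =>
    have huv : T.G.Adj u v := by simpa using he
    rw [Sym2.lift_mk] at heq
    dsimp only at heq
    rw [← heq] at hmin
    rcases Sym2.eq_iff.1 heq with ⟨rfl, -⟩ | ⟨-, rfl⟩
    · exact ⟨u, MTree.degree_eq_one_and_label_eq_part hsys huv hmin⟩
    · rw [Sym2.eq_swap] at hmin
      exact ⟨v, MTree.degree_eq_one_and_label_eq_part hsys huv.symm hmin⟩
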